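/- Let M be a real n×n P-matrix with β(M) = max over diagonal matrices D = diag(d), d ∈ [0,1]ⁿ, of ‖(I − D + DM)⁻¹ D‖. Let ΔM be a real n×n matrix with β(M)·‖ΔM‖ < 1. Then for every diagonal matrix D with diagonal entries in [0,1] the matrix I − D + D(M + ΔM) is nonsingular, and consequently M + ΔM is a P-matrix. -/

import Mathlib

/-- `A` is a P-matrix: every principal minor is positive. -/
def IsPMatrix {n : ℕ} (A : Matrix (Fin n) (Fin n) ℝ) : Prop :=
  ∀ J : Finset (Fin n), J.Nonempty →
    0 < (A.submatrix (fun j : J => (j : Fin n)) (fun j : J => (j : Fin n))).det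

/-- `β(A) = max_{d ∈ [0,1]ⁿ} ‖(I − D + D A)⁻¹ D‖`, where `D = diag(d)` and `‖·‖` is the
operator norm induced by the Euclidean norm. -/
noncomputable def betaP {n : ℕ} (A : Matrix (Fin n) (Fin n) ℝ) : ℝ :=
  sSup ((fun d : Fin n → ℝ =>
      ‖Matrix.toEuclideanCLM (𝕜 := ℝ)
        ((1 - Matrix.diagonal d + Matrix.diagonal d * A)⁻¹ * Matrix.diagonal d)‖) ''
    {d : Fin n → ℝ | ∀ i, d i ∈ Set.Icc (0 : ℝ) 1})

/-- Expansion of `det (I - D + D A)` over the principal minors of `A`. -/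
theorem det_one_sub_diagonal_add_diagonal_mul {ι R : Type*} [Fintype ι] [DecidableEq ι]
    [CommRing R] (A : Matrix ι ι R) (d : ι → R) :
    (1 - Matrix.diagonal d + Matrix.diagonal d * A).det =
      ∑ s : Finset ι, (∏ i, if i ∈ s then d i else 1 - d i) *
        (A.submatrix (fun j : s => (j : ι)) (fun j : s => (j : ι))).det := by
  have hrows : 1 - Matrix.diagonal d + Matrix.diagonal d * A =
      Matrix.of ((fun i => d i • A.row i) + fun i => (1 - d i) • (1 : Matrix ι ι R).row i) := by
    ext i j
    by_cases hij : i = j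
    · subst hij
      simp [add_comm]
    · simp [hij]
  rw [hrows]
  refine (Matrix.detRowAlternating.map_add_univ _ _).trans
    (Finset.sum_congr rfl fun s _ => ?_)
  have hsmul : s.piecewise (fun i => d i • A.row i)
      (fun i => (1 - d i) • (1 : Matrix ι ι R).row i) =
      fun i => (if i ∈ s then d i else 1 - d i) •
        s.piecewise A.row (1 : Matrix ι ι R).row i := by
    ext i j
    by_cases hi : i ∈ s <;> simp [hi]
  rw [hsmul, AlternatingMap.map_smul_univ, smul_eq_mul]
  exact congrArg _ (Matrix.det_piecewise_one_eq_submatrix_det A s)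

theorem IsPMatrix.det_one_sub_diagonal_add_diagonal_mul_pos {n : ℕ}
    {A : Matrix (Fin n) (Fin n) ℝ} (hA : IsPMatrix A) {d : Fin n → ℝ}
    (hd : ∀ i, d i ∈ Set.Icc (0 : ℝ) 1) :
    0 < (1 - Matrix.diagonal d + Matrix.diagonal d * A).det := by
  have hminor : ∀ s : Finset (Fin n),
      0 < (A.submatrix (fun j : s => (j : Fin n)) (fun j : s => (j : Fin n))).det := by
    intro s
    rcases s.eq_empty_or_nonempty with rfl | hs
    · simp
    · exact hA s hs
  rw [det_one_sub_diagonal_add_diagonal_mul]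
  refine Finset.sum_pos' (fun s _ => mul_nonneg (Finset.prod_nonneg fun i _ => ?_)
    (hminor s).le) ⟨Finset.univ.filter (d · ≠ 0), Finset.mem_univ _,
      mul_pos (Finset.prod_pos fun i _ => ?_) (hminor _)⟩
  · split_ifs
    · exact (hd i).1
    · exact sub_nonneg.2 (hd i).2
  · by_cases hi : d i = 0
    · simp [hi]
    · simpa [hi] using (hd i).1.lt_of_ne' hi

/-- A matrix `A` is a P-matrix as soon as `I - D + D A` is nonsingular for every diagonal
matrix `D` with entries in `[0,1]`. -/
theorem IsPMatrix.of_det_ne_zero {n : ℕ} {A : Matrix (Fin n) (Fin n) ℝ}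
    (hA : ∀ d : Fin n → ℝ, (∀ i, d i ∈ Set.Icc (0 : ℝ) 1) →
      (1 - Matrix.diagonal d + Matrix.diagonal d * A).det ≠ 0) :
    IsPMatrix A := by
  intro J _
  let e : Fin n → ℝ := fun i => if i ∈ J then 1 else 0
  let f : ℝ → ℝ := fun t =>
    (1 - Matrix.diagonal (t • e) + Matrix.diagonal (t • e) * A).det
  have hcont : Continuous f := by
    have hdiag : Continuous fun t : ℝ => Matrix.diagonal (t • e) := by fun_prop
    exact ((continuous_const.sub hdiag).add (hdiag.mul continuous_const)).matrix_det
  have hne : ∀ t ∈ Set.Icc (0 : ℝ) 1, f t ≠ 0 := by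
    refine fun t ht => hA _ fun i => ?_
    by_cases hi : i ∈ J <;> simp [e, hi, ht.1, ht.2]
  have hzero : f 0 = 1 := by simp [f]
  have hone : f 1 =
      (A.submatrix (fun j : J => (j : Fin n)) (fun j : J => (j : Fin n))).det := by
    rw [← Matrix.det_piecewise_one_eq_submatrix_det]
    refine congrArg Matrix.det ?_
    ext i j
    by_cases hij : i = j
    · subst hij
      by_cases hi : i ∈ J <;> simp [e, hi]
    · by_cases hi : i ∈ J <;> simp [e, hi, hij]
  rw [← hone]
  by_contra! hneg
  obtain ⟨t, ht, hft⟩ := intermediate_value_Icc' zero_le_one hcont.continuousOn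
    (⟨hneg, hzero ▸ zero_le_one⟩ : (0 : ℝ) ∈ Set.Icc (f 1) (f 0))
  exact hne t ht hft

theorem IsPMatrix.norm_le_betaP {n : ℕ} {A : Matrix (Fin n) (Fin n) ℝ} (hA : IsPMatrix A)
    {d : Fin n → ℝ} (hd : ∀ i, d i ∈ Set.Icc (0 : ℝ) 1) :
    ‖Matrix.toEuclideanCLM (𝕜 := ℝ)
      ((1 - Matrix.diagonal d + Matrix.diagonal d * A)⁻¹ * Matrix.diagonal d)‖ ≤ betaP A := by
  refine le_csSup (IsCompact.bddAbove_image ?_ ?_) (Set.mem_image_of_mem _ hd)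
  · simpa [Set.pi] using isCompact_univ_pi fun _ : Fin n => isCompact_Icc (a := (0 : ℝ)) (b := 1)
  · have hlin : Continuous (Matrix.toEuclideanCLM (n := Fin n) (𝕜 := ℝ)) :=
      LinearMap.continuous_of_finiteDimensional
        (Matrix.toEuclideanCLM (n := Fin n) (𝕜 := ℝ)).toAlgEquiv.toLinearMap
    have hdiag : Continuous fun d : Fin n → ℝ => Matrix.diagonal d := by fun_prop
    have hmat : Continuous fun d : Fin n → ℝ =>
        1 - Matrix.diagonal d + Matrix.diagonal d * A :=
      (continuous_const.sub hdiag).add (hdiag.mul continuous_const)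
    intro x hx
    have hinv := continuousAt_matrix_inv (1 - Matrix.diagonal x + Matrix.diagonal x * A)
      (by
        rw [Ring.inverse_eq_inv']
        exact continuousAt_inv₀ (hA.det_one_sub_diagonal_add_diagonal_mul_pos hx).ne')
    exact (hlin.continuousAt.comp ((ContinuousAt.comp (f := fun d : Fin n → ℝ =>
      1 - Matrix.diagonal d + Matrix.diagonal d * A) hinv hmat.continuousAt).mul
      hdiag.continuousAt)).norm.continuousWithinAt

/-- If `M` is a P-matrix and `β(M)·‖ΔM‖ < 1`, then `I − D + D(M + ΔM)` is nonsingular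
for every diagonal matrix `D` with entries in `[0,1]`, and consequently `M + ΔM` is a
P-matrix. -/
theorem stmt_10 {n : ℕ} (M ΔM : Matrix (Fin n) (Fin n) ℝ)
    (hM : IsPMatrix M)
    (hsmall : betaP M * ‖Matrix.toEuclideanCLM (𝕜 := ℝ) ΔM‖ < 1) :
    (∀ d : Fin n → ℝ, (∀ i, d i ∈ Set.Icc (0 : ℝ) 1) →
        (1 - Matrix.diagonal d + Matrix.diagonal d * (M + ΔM)).det ≠ 0) ∧
    IsPMatrix (M + ΔM) := by
  suffices hdet : ∀ d : Fin n → ℝ, (∀ i, d i ∈ Set.Icc (0 : ℝ) 1) →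
      (1 - Matrix.diagonal d + Matrix.diagonal d * (M + ΔM)).det ≠ 0 from
    ⟨hdet, IsPMatrix.of_det_ne_zero hdet⟩
  intro d hd
  set B := 1 - Matrix.diagonal d + Matrix.diagonal d * M with hB
  have hBdet : IsUnit B.det :=
    (hM.det_one_sub_diagonal_add_diagonal_mul_pos hd).ne'.isUnit
  have hfactor : 1 - Matrix.diagonal d + Matrix.diagonal d * (M + ΔM) =
      B * (1 - -(B⁻¹ * Matrix.diagonal d * ΔM)) := by
    rw [sub_neg_eq_add, mul_add B, mul_one, mul_assoc, Matrix.mul_nonsing_inv_cancel_left _ _ hBdet,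
      mul_add, ← add_assoc]
  have hnorm : ‖Matrix.toEuclideanCLM (𝕜 := ℝ) (-(B⁻¹ * Matrix.diagonal d * ΔM))‖ < 1 := by
    rw [map_neg, norm_neg, map_mul]
    exact (norm_mul_le _ _).trans_lt
      ((mul_le_mul_of_nonneg_right (hM.norm_le_betaP hd) (norm_nonneg _)).trans_lt hsmall)
  have hunit : IsUnit (1 - -(B⁻¹ * Matrix.diagonal d * ΔM)) := by
    rw [← isUnit_map_iff (Matrix.toEuclideanCLM (n := Fin n) (𝕜 := ℝ)), map_sub, map_one]
    exact (Units.oneSub _ hnorm).isUnit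
  rw [hfactor, Matrix.det_mul]
  exact (hBdet.mul ((Matrix.isUnit_iff_isUnit_det _).1 hunit)).ne_zero
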